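/- Let q be an odd prime power, F = F_q, and let ε ∈ F be a nonsquare. Let W₉ = {[[a,b,0],[b,c,0],[0,0,−c]] : a,b,c ∈ F} and W₁₀ = {[[a,b,0],[b,c,0],[0,0,−εc]] : a,b,c ∈ F} be subspaces of Sym₃(F) (representatives of the orbits Σ₉ and Σ₁₀). Then W₉ has point-orbit distribution [1, 2q, 0, q²−q] and W₁₀ has point-orbit distribution [1, q, q, q²−q]. -/

import Mathlib

open Matrix

/-- The number of points (1-dimensional subspaces) contained in a set `S` of `3 × 3`
matrices whose (nonzero) spanning matrices satisfy the property `P`. -/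
noncomputable def ptsWith (F : Type*) [Field F] (S : Set (Matrix (Fin 3) (Fin 3) F))
    (P : Matrix (Fin 3) (Fin 3) F → Prop) : ℕ :=
  Set.ncard {p : Submodule F (Matrix (Fin 3) (Fin 3) F) |
    ↑p ⊆ S ∧ Module.finrank F ↥p = 1 ∧ ∃ M ∈ p, M ≠ 0 ∧ P M}

/-- A matrix is exterior if it is congruent to `diag(1, −1, 0)`. -/
def Exterior {F : Type*} [Field F] (M : Matrix (Fin 3) (Fin 3) F) : Prop :=
  ∃ A : Matrix (Fin 3) (Fin 3) F, IsUnit A ∧ A * M * Aᵀ = diagonal ![1, -1, 0]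

/-- A matrix is interior if it is congruent to `diag(1, −ε, 0)` for some nonsquare `ε`. -/
def Interior {F : Type*} [Field F] (M : Matrix (Fin 3) (Fin 3) F) : Prop :=
  ∃ (A : Matrix (Fin 3) (Fin 3) F) (ε : F), IsUnit A ∧ ¬ IsSquare ε ∧
    A * M * Aᵀ = diagonal ![1, -ε, 0]

/-- `S` has point-orbit distribution `[n₁, n₂, n₃, n₄]`: it contains `n₁` rank-1 points,
`n₂` exterior rank-2 points, `n₃` interior rank-2 points and `n₄` rank-3 points. -/
def HasPointOrbitDistribution (F : Type*) [Field F] (S : Set (Matrix (Fin 3) (Fin 3) F))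
    (n₁ n₂ n₃ n₄ : ℕ) : Prop :=
  ptsWith F S (fun M => M.rank = 1) = n₁ ∧
  ptsWith F S Exterior = n₂ ∧
  ptsWith F S Interior = n₃ ∧
  ptsWith F S (fun M => M.rank = 3) = n₄

/-- The points of a cone `S` whose nonzero matrices satisfy `P` are counted by any system of
pairwise non-proportional representatives. -/
theorem ptsWith_eq_card {F : Type*} [Field F] {ι : Type*} [Fintype ι]
    {S : Set (Matrix (Fin 3) (Fin 3) F)} {P : Matrix (Fin 3) (Fin 3) F → Prop}
    (f : ι → Matrix (Fin 3) (Fin 3) F)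
    (hS : ∀ M ∈ S, ∀ t : F, t • M ∈ S)
    (hf : ∀ i, f i ∈ S ∧ f i ≠ 0 ∧ P (f i))
    (hinj : ∀ i j, ∀ t : F, f i = t • f j → i = j)
    (hsurj : ∀ M ∈ S, M ≠ 0 → P M → ∃ i, ∃ t : F, t ≠ 0 ∧ M = t • f i) :
    ptsWith F S P = Fintype.card ι := by
  have key : {p : Submodule F (Matrix (Fin 3) (Fin 3) F) |
      ↑p ⊆ S ∧ Module.finrank F ↥p = 1 ∧ ∃ M ∈ p, M ≠ 0 ∧ P M} =
      (fun i => F ∙ f i) '' Set.univ := by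
    ext p
    constructor
    · rintro ⟨hpS, hp, M, hM, hM0, hPM⟩
      obtain ⟨i, t, ht, rfl⟩ := hsurj M (hpS hM) hM0 hPM
      have hi : f i ∈ p := by simpa [smul_smul, ht] using p.smul_mem t⁻¹ hM
      have : FiniteDimensional F p := Module.finite_of_finrank_eq_succ hp
      refine ⟨i, trivial, Submodule.eq_of_le_of_finrank_eq ?_ ?_⟩
      · simpa using hi
      · rw [hp, finrank_span_singleton (hf i).2.1]
    · rintro ⟨i, -, rfl⟩
      refine ⟨?_, finrank_span_singleton (hf i).2.1, f i, Submodule.mem_span_singleton_self _,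
        (hf i).2⟩
      intro M hM
      obtain ⟨t, rfl⟩ := Submodule.mem_span_singleton.1 hM
      exact hS _ (hf i).1 t
  rw [ptsWith, key, Set.ncard_image_of_injective, Set.ncard_univ, Nat.card_eq_fintype_card]
  intro i j hij
  have : f i ∈ F ∙ f j := by
    rw [← show (F ∙ f i) = F ∙ f j from hij]
    exact Submodule.mem_span_singleton_self _
  obtain ⟨t, ht⟩ := Submodule.mem_span_singleton.1 this
  exact hinj i j t ht.symm

section Congruence

variable {F : Type*} [Field F]

theorem rank_congruence {A M : Matrix (Fin 3) (Fin 3) F} (hA : IsUnit A) :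
    (A * M * Aᵀ).rank = M.rank := by
  have h := (isUnit_iff_isUnit_det A).1 hA
  rw [rank_mul_eq_left_of_isUnit_det _ _ (by rwa [det_transpose]),
    rank_mul_eq_right_of_isUnit_det _ _ h]

theorem rank_diagonal_pair {x y : F} (hx : x ≠ 0) (hy : y ≠ 0) :
    (diagonal ![x, y, 0]).rank = 2 := by
  classical
  rw [rank_diagonal, Fintype.card_subtype]
  have : (Finset.univ.filter fun i : Fin 3 => ![x, y, 0] i ≠ 0) = {0, 1} := by
    ext i
    fin_cases i <;> simp [hx, hy]
  rw [this]
  rfl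

theorem Exterior.rank_eq {M : Matrix (Fin 3) (Fin 3) F} (h : Exterior M) : M.rank = 2 := by
  obtain ⟨A, hA, h⟩ := h
  rw [← rank_congruence hA, h, rank_diagonal_pair] <;> simp

theorem Interior.rank_eq {M : Matrix (Fin 3) (Fin 3) F} (h : Interior M) : M.rank = 2 := by
  obtain ⟨A, ε, hA, hε, h⟩ := h
  rw [← rank_congruence hA, h, rank_diagonal_pair one_ne_zero]
  rintro h0
  exact hε (by simp [neg_eq_zero.1 h0])

theorem Exterior.not_interior {M : Matrix (Fin 3) (Fin 3) F} (h : Exterior M) :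
    ¬ Interior M := by
  rintro ⟨A, ε, hA, hε, hI⟩
  obtain ⟨B, hB, hE⟩ := h
  obtain ⟨C, hC⟩ := hB.exists_left_inv
  have hM : M = C * diagonal ![1, -1, 0] * Cᵀ := by
    rw [← hE]
    calc M = (C * B) * M * (C * B)ᵀ := by simp [hC]
      _ = _ := by simp [transpose_mul, Matrix.mul_assoc]
  have hD : (A * C) * diagonal ![1, -1, 0] * (A * C)ᵀ = diagonal ![1, -ε, 0] := by
    rw [← hI, hM]
    simp [transpose_mul, Matrix.mul_assoc]
  generalize A * C = D at hD
  have h00 := congrFun₂ hD 0 0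
  have h01 := congrFun₂ hD 0 1
  have h11 := congrFun₂ hD 1 1
  simp [Matrix.mul_apply, Fin.sum_univ_three, diagonal_apply] at h00 h01 h11
  refine hε ⟨D 0 0 * D 1 1 - D 0 1 * D 1 0, ?_⟩
  linear_combination (D 1 0 ^ 2 - D 1 1 ^ 2) * h00 + h11 -
    (D 0 0 * D 1 0 - D 0 1 * D 1 1) * h01

theorem Exterior.smul (h2 : (2 : F) ≠ 0) {M : Matrix (Fin 3) (Fin 3) F} (h : Exterior M)
    {t : F} (ht : t ≠ 0) : Exterior (t • M) := by
  obtain ⟨A, hA, h⟩ := h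
  set B : Matrix (Fin 3) (Fin 3) F :=
    !![(1 + t⁻¹) / 2, (1 - t⁻¹) / 2, 0; (1 - t⁻¹) / 2, (1 + t⁻¹) / 2, 0; 0, 0, 1] with hBdef
  have hB : IsUnit B := by
    rw [isUnit_iff_isUnit_det, isUnit_iff_ne_zero]
    have : B.det = t⁻¹ := by
      simp [hBdef, det_fin_three]
      field_simp
      ring
    rw [this]
    exact inv_ne_zero ht
  refine ⟨B * A, hB.mul hA, ?_⟩
  have : B * A * (t • M) * (B * A)ᵀ = t • (B * (A * M * Aᵀ) * Bᵀ) := by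
    simp [transpose_mul, Matrix.mul_assoc]
  rw [this, h]
  ext i j
  rw [Matrix.smul_apply, Matrix.mul_apply, Fin.sum_univ_three]
  fin_cases i <;> fin_cases j <;>
    simp [hBdef, ht] <;> field_simp <;> ring

end Congruence

section Plane

variable {F : Type*} [Field F]

/-- The general matrix of the plane `Σ₉` (for `δ = 1`) or `Σ₁₀` (for `δ` a nonsquare). -/
def planeMatrix (δ a b c : F) : Matrix (Fin 3) (Fin 3) F :=
  !![a, b, 0; b, c, 0; 0, 0, -(δ * c)]

theorem smul_planeMatrix (δ a b c t : F) :
    t • planeMatrix δ a b c = planeMatrix δ (t * a) (t * b) (t * c) := by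
  ext i j
  fin_cases i <;> fin_cases j <;> simp [planeMatrix]
  ring

theorem planeMatrix_inj {δ a b c a' b' c' : F} :
    planeMatrix δ a b c = planeMatrix δ a' b' c' ↔ a = a' ∧ b = b' ∧ c = c' := by
  refine ⟨fun h => ⟨?_, ?_, ?_⟩, ?_⟩
  · simpa [planeMatrix] using congrFun₂ h 0 0
  · simpa [planeMatrix] using congrFun₂ h 0 1
  · simpa [planeMatrix] using congrFun₂ h 1 1
  · rintro ⟨rfl, rfl, rfl⟩
    rfl

theorem planeMatrix_eq_zero {δ a b c : F} :
    planeMatrix δ a b c = 0 ↔ a = 0 ∧ b = 0 ∧ c = 0 := by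
  rw [← planeMatrix_inj (δ := δ)]
  have : planeMatrix δ 0 0 0 = 0 := by
    ext i j
    fin_cases i <;> fin_cases j <;> simp [planeMatrix]
  rw [this]

theorem exterior_planeMatrix_zero (h2 : (2 : F) ≠ 0) (δ a : F) {b : F} (hb : b ≠ 0) :
    Exterior (planeMatrix δ a b 0) := by
  refine ⟨!![1, (1 - a) / (2 * b), 0; 1, -(1 + a) / (2 * b), 0; 0, 0, 1], ?_, ?_⟩
  · rw [isUnit_iff_isUnit_det, isUnit_iff_ne_zero]
    have : det !![1, (1 - a) / (2 * b), 0; 1, -(1 + a) / (2 * b), 0; 0, 0, 1] = -b⁻¹ := by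
      simp [det_fin_three]
      field_simp
      ring
    rw [this]
    simpa using hb
  · ext i j
    fin_cases i <;> fin_cases j <;>
      simp [planeMatrix, Matrix.mul_apply, Fin.sum_univ_three] <;>
      field_simp <;> ring

theorem planeMatrix_congruent_diagonal (δ : F) {a b c : F} (hc : c ≠ 0) (h : a * c = b ^ 2) :
    ∃ A : Matrix (Fin 3) (Fin 3) F, IsUnit A ∧
      A * planeMatrix δ a b c * Aᵀ = diagonal ![c, -(δ * c), 0] := by
  obtain rfl : a = b ^ 2 / c := by rw [← h]; field_simp
  refine ⟨!![0, 1, 0; 0, 0, 1; 1, -(b / c), 0], ?_, ?_⟩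
  · rw [isUnit_iff_isUnit_det, isUnit_iff_ne_zero]
    simp [det_fin_three]
  · ext i j
    fin_cases i <;> fin_cases j <;>
      simp [planeMatrix, Matrix.mul_apply, Fin.sum_univ_three] <;>
      field_simp <;> ring

theorem rank_planeMatrix_eq_one {δ a : F} (ha : a ≠ 0) : (planeMatrix δ a 0 0).rank = 1 := by
  classical
  have : planeMatrix δ a 0 0 = diagonal ![a, 0, 0] := by
    ext i j
    fin_cases i <;> fin_cases j <;> simp [planeMatrix]
  rw [this, rank_diagonal, Fintype.card_subtype]
  have : (Finset.univ.filter fun i : Fin 3 => ![a, 0, 0] i ≠ 0) = {0} := by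
    ext i
    fin_cases i <;> simp [ha]
  rw [this]
  rfl

theorem rank_planeMatrix_eq_two {δ : F} (hδ : δ ≠ 0) {a b c : F} (hc : c ≠ 0)
    (h : a * c = b ^ 2) : (planeMatrix δ a b c).rank = 2 := by
  obtain ⟨A, hA, h⟩ := planeMatrix_congruent_diagonal δ hc h
  rw [← rank_congruence hA, h, rank_diagonal_pair hc]
  simp [hδ, hc]

theorem rank_planeMatrix_eq_three {δ : F} (hδ : δ ≠ 0) {a b c : F} (hc : c ≠ 0)
    (h : a * c ≠ b ^ 2) : (planeMatrix δ a b c).rank = 3 := by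
  rw [rank_of_isUnit, Fintype.card_fin]
  rw [isUnit_iff_isUnit_det, isUnit_iff_ne_zero]
  have : (planeMatrix δ a b c).det = -(δ * c * (a * c - b ^ 2)) := by
    simp [planeMatrix, det_fin_three]
    ring
  rw [this]
  simp [hδ, hc, sub_eq_zero, h]

theorem smul_mem_plane {δ : F} (M : Matrix (Fin 3) (Fin 3) F)
    (hM : M ∈ {M | ∃ a b c : F, M = planeMatrix δ a b c}) (t : F) :
    t • M ∈ {M | ∃ a b c : F, M = planeMatrix δ a b c} := by
  obtain ⟨a, b, c, rfl⟩ := hM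
  exact ⟨_, _, _, smul_planeMatrix ..⟩

theorem ptsWith_plane_rank_one (h2 : (2 : F) ≠ 0) {δ : F} (hδ : δ ≠ 0) :
    ptsWith F {M | ∃ a b c : F, M = planeMatrix δ a b c} (fun M => M.rank = 1) = 1 := by
  refine (ptsWith_eq_card (ι := Unit) (fun _ => planeMatrix δ 1 0 0) smul_mem_plane
    (fun _ => ⟨⟨_, _, _, rfl⟩, by simp [planeMatrix_eq_zero],
      rank_planeMatrix_eq_one one_ne_zero⟩) (fun _ _ _ _ => rfl) ?_).trans (by simp)
  rintro _ ⟨a, b, c, rfl⟩ h0 hr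
  by_cases hc : c = 0
  · subst hc
    by_cases hb : b = 0
    · subst hb
      refine ⟨(), a, ?_, by simp [smul_planeMatrix]⟩
      rintro rfl
      exact h0 (by simp [planeMatrix_eq_zero])
    · simp [(exterior_planeMatrix_zero h2 δ a hb).rank_eq] at hr
  · by_cases h : a * c = b ^ 2
    · simp [rank_planeMatrix_eq_two hδ hc h] at hr
    · simp [rank_planeMatrix_eq_three hδ hc h] at hr

/-- Classification of the rank two matrices of the plane up to scalars. -/
theorem planeMatrix_of_rank_two {δ : F} (hδ : δ ≠ 0) {a b c : F}
    (hr : (planeMatrix δ a b c).rank = 2) :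
    (∃ x, b ≠ 0 ∧ planeMatrix δ a b c = b • planeMatrix δ x 1 0) ∨
      ∃ x, c ≠ 0 ∧ planeMatrix δ a b c = c • planeMatrix δ (x ^ 2) x 1 := by
  simp only [smul_planeMatrix, planeMatrix_inj]
  by_cases hc : c = 0
  · subst hc
    by_cases hb : b = 0
    · subst hb
      by_cases ha : a = 0
      · rw [planeMatrix_eq_zero.2 ⟨ha, rfl, rfl⟩] at hr
        simp at hr
      · simp [rank_planeMatrix_eq_one ha] at hr
    · exact Or.inl ⟨a / b, hb, by field_simp, by simp, by simp⟩
  · by_cases h : a * c = b ^ 2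
    · refine Or.inr ⟨b / c, hc, ?_, by field_simp, by simp⟩
      field_simp
      exact h
    · simp [rank_planeMatrix_eq_three hδ hc h] at hr

theorem exterior_planeMatrix_one (b : F) : Exterior (planeMatrix 1 (b ^ 2) b 1) := by
  simpa [Exterior] using planeMatrix_congruent_diagonal 1 one_ne_zero (mul_one (b ^ 2))

theorem interior_planeMatrix_one {ε : F} (hε : ¬ IsSquare ε) (b : F) :
    Interior (planeMatrix ε (b ^ 2) b 1) := by
  obtain ⟨A, hA, h⟩ := planeMatrix_congruent_diagonal ε one_ne_zero (mul_one (b ^ 2))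
  exact ⟨A, ε, hA, hε, by simpa using h⟩

theorem planeMatrix_zero_injective {δ a a' t : F}
    (h : planeMatrix δ a 1 0 = t • planeMatrix δ a' 1 0) : a = a' := by
  rw [smul_planeMatrix, planeMatrix_inj] at h
  obtain ⟨h₁, h₂, -⟩ := h
  obtain rfl : t = 1 := by simpa using h₂.symm
  simpa using h₁

theorem planeMatrix_one_injective {δ b b' t : F}
    (h : planeMatrix δ (b ^ 2) b 1 = t • planeMatrix δ (b' ^ 2) b' 1) : b = b' := by
  rw [smul_planeMatrix, planeMatrix_inj] at h
  obtain ⟨-, h₂, h₃⟩ := h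
  obtain rfl : t = 1 := by simpa using h₃.symm
  simpa using h₂

theorem ptsWith_plane_one_interior (h2 : (2 : F) ≠ 0) :
    ptsWith F {M | ∃ a b c : F, M = planeMatrix 1 a b c} Interior = 0 := by
  refine (ptsWith_eq_card (ι := Empty) Empty.elim smul_mem_plane (fun i => i.elim)
    (fun i => i.elim) ?_).trans (by simp)
  rintro _ ⟨a, b, c, rfl⟩ - hI
  rcases planeMatrix_of_rank_two one_ne_zero hI.rank_eq with ⟨x, hx, h⟩ | ⟨x, hx, h⟩
  · rw [h] at hI
    exact (((exterior_planeMatrix_zero h2 1 x one_ne_zero).smul h2 hx).not_interior hI).elim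
  · rw [h] at hI
    exact (((exterior_planeMatrix_one x).smul h2 hx).not_interior hI).elim

variable [Fintype F]

theorem ptsWith_plane_rank_three (h2 : (2 : F) ≠ 0) {δ : F} (hδ : δ ≠ 0) :
    ptsWith F {M | ∃ a b c : F, M = planeMatrix δ a b c} (fun M => M.rank = 3) =
      Fintype.card F ^ 2 - Fintype.card F := by
  classical
  refine (ptsWith_eq_card (ι := F × Fˣ) (fun x => planeMatrix δ (x.1 ^ 2 + x.2) x.1 1)
    smul_mem_plane (fun x => ⟨⟨_, _, _, rfl⟩, by simp [planeMatrix_eq_zero],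
      rank_planeMatrix_eq_three hδ one_ne_zero (by simp)⟩) ?_ ?_).trans ?_
  · rintro ⟨b, d⟩ ⟨b', d'⟩ t h
    rw [smul_planeMatrix, planeMatrix_inj] at h
    obtain ⟨h₁, h₂, h₃⟩ := h
    obtain rfl : t = 1 := by simpa using h₃.symm
    obtain rfl : b = b' := by simpa using h₂
    simpa [Units.ext_iff] using h₁
  · rintro _ ⟨a, b, c, rfl⟩ h0 hr
    by_cases hc : c = 0
    · subst hc
      by_cases hb : b = 0
      · subst hb
        have ha : a ≠ 0 := fun ha => h0 (by simp [planeMatrix_eq_zero, ha])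
        simp [rank_planeMatrix_eq_one ha] at hr
      · simp [(exterior_planeMatrix_zero h2 δ a hb).rank_eq] at hr
    · by_cases h : a * c = b ^ 2
      · simp [rank_planeMatrix_eq_two hδ hc h] at hr
      · have hd : a / c - (b / c) ^ 2 ≠ 0 := by
          intro h'
          apply h
          field_simp at h'
          linear_combination h'
        refine ⟨(b / c, Units.mk0 _ hd), c, hc, ?_⟩
        rw [smul_planeMatrix, planeMatrix_inj]
        refine ⟨?_, ?_, ?_⟩ <;> simp <;> field_simp
  · rw [Fintype.card_prod, Fintype.card_units, Nat.mul_sub, mul_one, sq]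

theorem ptsWith_plane_one_exterior (h2 : (2 : F) ≠ 0) :
    ptsWith F {M | ∃ a b c : F, M = planeMatrix 1 a b c} Exterior = 2 * Fintype.card F := by
  refine (ptsWith_eq_card (ι := F ⊕ F)
    (Sum.elim (fun a => planeMatrix 1 a 1 0) (fun b => planeMatrix 1 (b ^ 2) b 1))
    smul_mem_plane ?_ ?_ ?_).trans (by simp [two_mul])
  · rintro (a | b)
    · exact ⟨⟨_, _, _, rfl⟩, by simp [planeMatrix_eq_zero],
        exterior_planeMatrix_zero h2 1 a one_ne_zero⟩
    · exact ⟨⟨_, _, _, rfl⟩, by simp [planeMatrix_eq_zero], exterior_planeMatrix_one b⟩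
  · rintro (a | b) (a' | b') t h
    · rw [planeMatrix_zero_injective h]
    · simp only [Sum.elim_inl, Sum.elim_inr, smul_planeMatrix, planeMatrix_inj] at h
      obtain ⟨-, h₂, h₃⟩ := h
      obtain rfl : t = 0 := by simpa using h₃.symm
      simp at h₂
    · simp [smul_planeMatrix, planeMatrix_inj] at h
    · rw [planeMatrix_one_injective h]
  · rintro _ ⟨a, b, c, rfl⟩ - hE
    rcases planeMatrix_of_rank_two one_ne_zero hE.rank_eq with ⟨x, hx, h⟩ | ⟨x, hx, h⟩
    · exact ⟨Sum.inl x, _, hx, h⟩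
    · exact ⟨Sum.inr x, _, hx, h⟩

theorem ptsWith_plane_nonsquare_exterior (h2 : (2 : F) ≠ 0) {ε : F} (hε : ¬ IsSquare ε) :
    ptsWith F {M | ∃ a b c : F, M = planeMatrix ε a b c} Exterior = Fintype.card F := by
  have hε0 : ε ≠ 0 := by
    rintro rfl
    exact hε (by simp)
  refine ptsWith_eq_card (fun a => planeMatrix ε a 1 0) smul_mem_plane
    (fun a => ⟨⟨_, _, _, rfl⟩, by simp [planeMatrix_eq_zero],
      exterior_planeMatrix_zero h2 ε a one_ne_zero⟩)
    (fun _ _ _ => planeMatrix_zero_injective) ?_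
  rintro _ ⟨a, b, c, rfl⟩ - hE
  rcases planeMatrix_of_rank_two hε0 hE.rank_eq with ⟨x, hx, h⟩ | ⟨x, hx, h⟩
  · exact ⟨x, _, hx, h⟩
  · rw [h] at hE
    have hE' := hE.smul h2 (inv_ne_zero hx)
    rw [inv_smul_smul₀ hx] at hE'
    exact (hE'.not_interior (interior_planeMatrix_one hε x)).elim

theorem ptsWith_plane_nonsquare_interior (h2 : (2 : F) ≠ 0) {ε : F} (hε : ¬ IsSquare ε) :
    ptsWith F {M | ∃ a b c : F, M = planeMatrix ε a b c} Interior = Fintype.card F := by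
  have hε0 : ε ≠ 0 := by
    rintro rfl
    exact hε (by simp)
  refine ptsWith_eq_card (fun b => planeMatrix ε (b ^ 2) b 1) smul_mem_plane
    (fun b => ⟨⟨_, _, _, rfl⟩, by simp [planeMatrix_eq_zero], interior_planeMatrix_one hε b⟩)
    (fun _ _ _ => planeMatrix_one_injective) ?_
  rintro _ ⟨a, b, c, rfl⟩ - hI
  rcases planeMatrix_of_rank_two hε0 hI.rank_eq with ⟨x, hx, h⟩ | ⟨x, hx, h⟩
  · rw [h] at hI
    exact (((exterior_planeMatrix_zero h2 ε x one_ne_zero).smul h2 hx).not_interior hI).elim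
  · exact ⟨x, _, hx, h⟩

end Plane

/-- The plane `Σ₉` representative has point-orbit distribution `[1, 2q, 0, q²−q]` and the
plane `Σ₁₀` representative has point-orbit distribution `[1, q, q, q²−q]`. -/
theorem distribution_Sigma9_Sigma10 (F : Type*) [Field F] [Fintype F]
    (hodd : Odd (Fintype.card F)) (ε : F) (hε : ¬ IsSquare ε) :
    HasPointOrbitDistribution F
      {M | ∃ a b c : F, M = !![a, b, 0; b, c, 0; 0, 0, -c]}
      1
      (2 * Fintype.card F)
      0
      (Fintype.card F ^ 2 - Fintype.card F) ∧
    HasPointOrbitDistribution F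
      {M | ∃ a b c : F, M = !![a, b, 0; b, c, 0; 0, 0, -(ε * c)]}
      1
      (Fintype.card F)
      (Fintype.card F)
      (Fintype.card F ^ 2 - Fintype.card F) := by
  have h2 : (2 : F) ≠ 0 := by
    refine Ring.two_ne_zero fun h => ?_
    have := FiniteField.even_card_of_char_two h
    rw [Nat.odd_iff] at hodd
    omega
  have hε0 : ε ≠ 0 := by
    rintro rfl
    exact hε (by simp)
  have h9 : {M | ∃ a b c : F, M = !![a, b, 0; b, c, 0; 0, 0, -c]} =
      {M | ∃ a b c : F, M = planeMatrix 1 a b c} := by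
    simp [planeMatrix]
  rw [h9]
  exact ⟨⟨ptsWith_plane_rank_one h2 one_ne_zero, ptsWith_plane_one_exterior h2,
      ptsWith_plane_one_interior h2, ptsWith_plane_rank_three h2 one_ne_zero⟩,
    ptsWith_plane_rank_one h2 hε0, ptsWith_plane_nonsquare_exterior h2 hε,
    ptsWith_plane_nonsquare_interior h2 hε, ptsWith_plane_rank_three h2 hε0⟩
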